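/- On ℝ² with the Euclidean cometric g, the Poisson bivector Π ∂₁∧∂₂ and the associated contravariant Levi-Civita connection D with curvature R, if a smooth 1-form η is a Killing 1-form and D_ηη = 0, then g(Δ^Dη, η) = Ric(η,η), where Δ^D is the contravariant Laplacian on 1-forms and Ric(ω,τ) = Σ_{i=1,2} g(R(ω,dxⁱ)dxⁱ, τ). -/

import Mathlib

noncomputable section

/-- Smooth scalar functions on `ℝ²`. -/
abbrev Fn : Type := (ℝ × ℝ) → ℝ

/-- A 1-form on `ℝ²` identified with its pair of component functions. -/
abbrev OneForm : Type := Fn × Fn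

/-- Partial derivative in the first coordinate direction. -/
def pd1 (f : Fn) : Fn := fun p => fderiv ℝ f p (1, 0)

/-- Partial derivative in the second coordinate direction. -/
def pd2 (f : Fn) : Fn := fun p => fderiv ℝ f p (0, 1)

/-- Smoothness of a function. -/
def SmoothFn (f : Fn) : Prop := ContDiff ℝ (⊤ : ℕ∞) f

/-- Smoothness of a 1-form. -/
def SmoothForm (ω : OneForm) : Prop := SmoothFn ω.1 ∧ SmoothFn ω.2

/-- The Euclidean cometric on 1-forms. -/
def gmet (ω τ : OneForm) : Fn := fun p => ω.1 p * τ.1 p + ω.2 p * τ.2 p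

/-- The sharp map `♯(ω)` acting on a function. -/
def sharpF (Pi : Fn) (ω : OneForm) (f : Fn) : Fn :=
  fun p => Pi p * (ω.1 p * pd2 f p - ω.2 p * pd1 f p)

/-- The contravariant Levi-Civita connection associated with `(g, Π)`. -/
def Dconn (Pi : Fn) (ω τ : OneForm) : OneForm :=
  (fun p => sharpF Pi ω τ.1 p + (ω.1 p * pd1 Pi p + ω.2 p * pd2 Pi p) * τ.2 p,
   fun p => sharpF Pi ω τ.2 p - (ω.1 p * pd1 Pi p + ω.2 p * pd2 Pi p) * τ.1 p)

/-- The sharp map as a vector field `(X¹, X²)`. -/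
def sharpVF (Pi : Fn) (ω : OneForm) : Fn × Fn :=
  (fun p => -(Pi p) * ω.2 p, fun p => Pi p * ω.1 p)

/-- Lie derivative of a 1-form along a vector field. -/
def lieVF (X : Fn × Fn) (τ : OneForm) : OneForm :=
  (fun p => X.1 p * pd1 τ.1 p + X.2 p * pd2 τ.1 p + τ.1 p * pd1 X.1 p + τ.2 p * pd1 X.2 p,
   fun p => X.1 p * pd1 τ.2 p + X.2 p * pd2 τ.2 p + τ.1 p * pd2 X.1 p + τ.2 p * pd2 X.2 p)

/-- The bivector evaluated on two 1-forms: `Π(ω,τ) = Π·(ω₁τ₂ − ω₂τ₁)`. -/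
def PiForm (Pi : Fn) (ω τ : OneForm) : Fn :=
  fun p => Pi p * (ω.1 p * τ.2 p - ω.2 p * τ.1 p)

/-- The exterior differential of a function, as a 1-form. -/
def dF (f : Fn) : OneForm := (pd1 f, pd2 f)

/-- The Koszul bracket of 1-forms. -/
def koszul (Pi : Fn) (ω τ : OneForm) : OneForm :=
  lieVF (sharpVF Pi ω) τ - lieVF (sharpVF Pi τ) ω - dF (PiForm Pi ω τ)

/-- Lie derivative of the cometric `g` along a 1-form `η`. -/
def lieG (Pi : Fn) (η α β : OneForm) : Fn :=
  fun p => sharpF Pi η (gmet α β) p - gmet (koszul Pi η α) β p - gmet α (koszul Pi η β) p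

/-- Second Lie derivative `(L_η (L_η g))(α, β)`. -/
def lie2G (Pi : Fn) (η α β : OneForm) : Fn :=
  fun p => sharpF Pi η (lieG Pi η α β) p - lieG Pi η (koszul Pi η α) β p
    - lieG Pi η α (koszul Pi η β) p

/-- `η` is a Killing 1-form. -/
def IsKilling (Pi : Fn) (η : OneForm) : Prop :=
  ∀ α β : OneForm, SmoothForm α → SmoothForm β → lieG Pi η α β = 0

/-- `η` is a 2-Killing 1-form. -/
def Is2Killing (Pi : Fn) (η : OneForm) : Prop :=
  ∀ α β : OneForm, SmoothForm α → SmoothForm β → lie2G Pi η α β = 0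

/-- Curvature of the contravariant connection. -/
def curv (Pi : Fn) (ω τ γ : OneForm) : OneForm :=
  Dconn Pi ω (Dconn Pi τ γ) - Dconn Pi τ (Dconn Pi ω γ) - Dconn Pi (koszul Pi ω τ) γ

/-- The coordinate 1-form `dx¹`. -/
def dx1 : OneForm := (fun _ => 1, fun _ => 0)

/-- The coordinate 1-form `dx²`. -/
def dx2 : OneForm := (fun _ => 0, fun _ => 1)

/-- Contravariant Laplacian on functions. -/
def lapF (Pi : Fn) (f : Fn) : Fn :=
  fun p => -((sharpF Pi dx1 (sharpF Pi dx1 f) p - sharpF Pi (Dconn Pi dx1 dx1) f p)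
    + (sharpF Pi dx2 (sharpF Pi dx2 f) p - sharpF Pi (Dconn Pi dx2 dx2) f p))

/-- Contravariant Laplacian on 1-forms. -/
def lapO (Pi : Fn) (η : OneForm) : OneForm :=
  -((Dconn Pi dx1 (Dconn Pi dx1 η) - Dconn Pi (Dconn Pi dx1 dx1) η)
    + (Dconn Pi dx2 (Dconn Pi dx2 η) - Dconn Pi (Dconn Pi dx2 dx2) η))

section PartialDerivatives

variable {f g : Fn} {p : ℝ × ℝ}

theorem pd1_add (hf : Differentiable ℝ f) (hg : Differentiable ℝ g) :
    pd1 (fun q => f q + g q) p = pd1 f p + pd1 g p := by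
  simp [pd1, fderiv_fun_add (hf p) (hg p)]

theorem pd2_add (hf : Differentiable ℝ f) (hg : Differentiable ℝ g) :
    pd2 (fun q => f q + g q) p = pd2 f p + pd2 g p := by
  simp [pd2, fderiv_fun_add (hf p) (hg p)]

theorem pd1_sub (hf : Differentiable ℝ f) (hg : Differentiable ℝ g) :
    pd1 (fun q => f q - g q) p = pd1 f p - pd1 g p := by
  simp [pd1, fderiv_fun_sub (hf p) (hg p)]

theorem pd2_sub (hf : Differentiable ℝ f) (hg : Differentiable ℝ g) :
    pd2 (fun q => f q - g q) p = pd2 f p - pd2 g p := by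
  simp [pd2, fderiv_fun_sub (hf p) (hg p)]

theorem pd1_mul (hf : Differentiable ℝ f) (hg : Differentiable ℝ g) :
    pd1 (fun q => f q * g q) p = f p * pd1 g p + g p * pd1 f p := by
  simp [pd1, fderiv_fun_mul (hf p) (hg p)]

theorem pd2_mul (hf : Differentiable ℝ f) (hg : Differentiable ℝ g) :
    pd2 (fun q => f q * g q) p = f p * pd2 g p + g p * pd2 f p := by
  simp [pd2, fderiv_fun_mul (hf p) (hg p)]

theorem pd1_neg : pd1 (fun q => -f q) p = -pd1 f p := by
  simp [pd1]

theorem pd2_neg : pd2 (fun q => -f q) p = -pd2 f p := by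
  simp [pd2]

theorem pd1_const (c : ℝ) : pd1 (fun _ => c) p = 0 := by
  simp [pd1]

theorem pd2_const (c : ℝ) : pd2 (fun _ => c) p = 0 := by
  simp [pd2]

theorem SmoothFn.differentiable (hf : SmoothFn f) : Differentiable ℝ f :=
  ContDiff.differentiable hf (by simp)

theorem SmoothFn.differentiable_pd1 (hf : SmoothFn f) : Differentiable ℝ (pd1 f) :=
  ((ContDiff.fderiv_right (m := 1) hf (WithTop.coe_le_coe.2 le_top)).differentiable
    one_ne_zero).clm_apply (differentiable_const _)

theorem SmoothFn.differentiable_pd2 (hf : SmoothFn f) : Differentiable ℝ (pd2 f) :=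
  ((ContDiff.fderiv_right (m := 1) hf (WithTop.coe_le_coe.2 le_top)).differentiable
    one_ne_zero).clm_apply (differentiable_const _)

/-- Mixed partial derivatives of a smooth function commute. -/
theorem SmoothFn.pd2_pd1 (hf : SmoothFn f) : pd2 (pd1 f) p = pd1 (pd2 f) p := by
  have hd : DifferentiableAt ℝ (fderiv ℝ f) p :=
    (ContDiff.fderiv_right (m := 1) hf (WithTop.coe_le_coe.2 le_top)).differentiable one_ne_zero p
  have hs : IsSymmSndFDerivAt ℝ f p :=
    (ContDiff.contDiffAt hf).isSymmSndFDerivAt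
      (by simpa using WithTop.coe_le_coe.2 (le_top (a := (2 : ℕ∞))))
  have h := hs.eq (0, 1) (1, 0)
  unfold pd1 pd2
  rw [fderiv_clm_apply hd (differentiableAt_const _), fderiv_clm_apply hd (differentiableAt_const _)]
  simpa using h

end PartialDerivatives

theorem smoothForm_dx1 : SmoothForm dx1 := ⟨contDiff_const, contDiff_const⟩

theorem smoothForm_dx2 : SmoothForm dx2 := ⟨contDiff_const, contDiff_const⟩

/-- The Killing equation in the coordinate coframe. -/
theorem IsKilling.components {Pi : Fn} {η : OneForm} (hPi : SmoothFn Pi) (hη : SmoothForm η)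
    (hK : IsKilling Pi η) (p : ℝ × ℝ) :
    Pi p * pd2 η.1 p + pd1 Pi p * η.2 p = 0 ∧
    Pi p * pd1 η.2 p + pd2 Pi p * η.1 p = 0 ∧
    Pi p * pd2 η.2 p - pd1 Pi p * η.1 p - Pi p * pd1 η.1 p + pd2 Pi p * η.2 p = 0 := by
  have h11 := congrFun (hK dx1 dx1 smoothForm_dx1 smoothForm_dx1) p
  have h22 := congrFun (hK dx2 dx2 smoothForm_dx2 smoothForm_dx2) p
  have h12 := congrFun (hK dx1 dx2 smoothForm_dx1 smoothForm_dx2) p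
  have dP := hPi.differentiable
  obtain ⟨a, b⟩ := η
  have da : Differentiable ℝ a := hη.1.differentiable
  have db : Differentiable ℝ b := hη.2.differentiable
  unfold lieG sharpF gmet koszul lieVF sharpVF dF PiForm at h11 h22 h12
  simp (maxDischargeDepth := 20) only [dP, da, db, Differentiable.fun_sub,
    Differentiable.fun_mul, Differentiable.fun_neg, differentiable_const, dx1, dx2, Prod.fst_sub,
    Prod.snd_sub, _root_.Pi.sub_apply, _root_.Pi.zero_apply, pd1_add, pd2_add, pd1_sub, pd2_sub,
    pd1_mul, pd2_mul, pd1_neg, pd2_neg, pd1_const, pd2_const] at h11 h22 h12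
  refine ⟨?_, ?_, ?_⟩
  · linear_combination h11 / 2
  · linear_combination -h22 / 2
  · linear_combination h12

theorem killing_laplacian_eq_ricci (Pi : Fn) (hPi : SmoothFn Pi)
    (η : OneForm) (hη : SmoothForm η) (hK : IsKilling Pi η)
    (hD : Dconn Pi η η = 0) :
    gmet (lapO Pi η) η
      = fun p => gmet (curv Pi η dx1 dx1) η p + gmet (curv Pi η dx2 dx2) η p := by
  have hc := hK.components hPi hη
  have dP := hPi.differentiable
  have dP1 := hPi.differentiable_pd1
  have dP2 := hPi.differentiable_pd2
  have sP := fun p => hPi.pd2_pd1 (p := p)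
  obtain ⟨a, b⟩ := η
  obtain ⟨ha, hb⟩ : SmoothFn a ∧ SmoothFn b := hη
  have da := ha.differentiable
  have da1 := ha.differentiable_pd1
  have da2 := ha.differentiable_pd2
  have sa := fun p => ha.pd2_pd1 (p := p)
  have db := hb.differentiable
  have db1 := hb.differentiable_pd1
  have db2 := hb.differentiable_pd2
  have sb := fun p => hb.pd2_pd1 (p := p)
  have k11 := fun p => (hc p).1
  have k22 := fun p => (hc p).2.1
  have k12 := fun p => (hc p).2.2
  funext p
  have k11x := congrArg (fun f => pd1 f p) (funext k11)
  have k11y := congrArg (fun f => pd2 f p) (funext k11)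
  have k22x := congrArg (fun f => pd1 f p) (funext k22)
  have k22y := congrArg (fun f => pd2 f p) (funext k22)
  have k12x := congrArg (fun f => pd1 f p) (funext k12)
  have k12y := congrArg (fun f => pd2 f p) (funext k12)
  simp (maxDischargeDepth := 20) only [dP, dP1, dP2, da, da1, da2, db, db1, db2,
    Differentiable.fun_sub, Differentiable.fun_mul, pd1_add, pd2_add,
    pd1_sub, pd2_sub, pd1_mul, pd2_mul, pd1_const, pd2_const, sP, sa, sb]
    at k11x k11y k22x k22y k12x k12y
  unfold gmet lapO curv Dconn koszul lieVF sharpVF dF PiForm sharpF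
  simp (maxDischargeDepth := 20) only [dP, dP1, dP2, da, da1, da2, db, db1, db2,
    Differentiable.fun_add, Differentiable.fun_sub, Differentiable.fun_mul, Differentiable.fun_neg,
    differentiable_const, dx1, dx2, Prod.fst_sub, Prod.snd_sub, Prod.fst_add, Prod.snd_add,
    Prod.fst_neg, Prod.snd_neg, _root_.Pi.sub_apply, _root_.Pi.add_apply, _root_.Pi.neg_apply,
    pd1_add, pd2_add, pd1_sub, pd2_sub, pd1_mul, pd2_mul, pd1_neg, pd2_neg, pd1_const, pd2_const,
    sP, sa, sb]
  linear_combination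
    -a p * (2 * Pi p * k11y + 2 * pd1 Pi p * k12 p - Pi p * k12x - 2 * pd2 Pi p * k11 p
      - 2 * pd2 Pi p * k22 p - Pi p * (k11y - k22y))
    - b p * (Pi p * k12y - 2 * pd1 Pi p * k22 p - 2 * pd1 Pi p * k11 p + 2 * Pi p * k22x
      - 2 * pd2 Pi p * k12 p + Pi p * (k11x - k22x))

end
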